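/- arXiv:2305.13879 — 4 statements merged into one kernel-verified Lean document; each statement's English description precedes it below -/
import Mathlib

section
/- Let Q be an invertible n_u×n_u real matrix, A an n_y×n_u real matrix, n_o a positive natural number, and σ a nonzero real number such that σ²Q + n_o·AᵀA is invertible. Let B be the (n_o·n_y)×n_u real matrix obtained by stacking n_o copies of A (i.e. B indexed by Fin n_o × Fin n_y with B (i,j) k = A j k). Then BᵀB = n_o·AᵀA, the matrix BQ⁻¹Bᵀ + σ²I is invertible, and (BQ⁻¹Bᵀ + σ²I)⁻¹ = σ⁻²( I − B (σ²Q + n_o·AᵀA)⁻¹ Bᵀ ). -/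
open Matrix

/-- A form of the Woodbury identity in which the only matrix inverted on the right-hand side is
`s • Q + V * U`. -/
theorem mul_inv_mul_add_smul_one_mul {m n R : Type*} [Fintype m] [DecidableEq m] [Fintype n]
    [DecidableEq n] [CommRing R] (Q : Matrix n n R) (U : Matrix m n R) (V : Matrix n m R) (s : R)
    (hQ : IsUnit Q.det) (hS : IsUnit (s • Q + V * U).det) :
    (U * Q⁻¹ * V + s • (1 : Matrix m m R)) * (1 - U * (s • Q + V * U)⁻¹ * V) =
      s • (1 : Matrix m m R) := by
  set S := s • Q + V * U with hSdef
  have hres : Q⁻¹ = s • S⁻¹ + Q⁻¹ * (V * U) * S⁻¹ := by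
    calc Q⁻¹ = Q⁻¹ * S * S⁻¹ := (mul_nonsing_inv_cancel_right S _ hS).symm
      _ = s • S⁻¹ + Q⁻¹ * (V * U) * S⁻¹ := by
        conv_lhs => enter [1]; rw [hSdef]
        rw [Matrix.mul_add, Matrix.mul_smul, nonsing_inv_mul Q hQ, Matrix.add_mul,
          Matrix.smul_mul, Matrix.one_mul]
  have hUV : U * Q⁻¹ * V = s • (U * S⁻¹ * V) + U * Q⁻¹ * V * (U * S⁻¹ * V) := by
    conv_lhs => rw [hres]
    simp only [Matrix.mul_add, Matrix.add_mul, Matrix.mul_smul, Matrix.smul_mul, Matrix.mul_assoc]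
  rw [Matrix.mul_sub, Matrix.mul_one, Matrix.add_mul, Matrix.smul_mul, Matrix.one_mul,
    add_comm (U * Q⁻¹ * V * _), ← hUV, add_sub_cancel_left]

/-- The Gram matrix of a stack of copies of `A` is a multiple of the Gram matrix of `A`. -/
theorem transpose_mul_self_of_stacked {ι m n R : Type*} [Fintype ι] [Fintype m] [CommRing R]
    (A : Matrix m n R) (B : Matrix (ι × m) n R) (hB : ∀ i j k, B (i, j) k = A j k) :
    Bᵀ * B = (Fintype.card ι : R) • (Aᵀ * A) := by
  ext k l
  simp [Matrix.mul_apply, Fintype.sum_prod_type, hB]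

/-- Repeated readings in GP regression: with `B` the stacking of `n_o` copies
of `A`, one has `BᵀB = n_o AᵀA`, the matrix `BQ⁻¹Bᵀ + σ²I` is invertible, and
`(BQ⁻¹Bᵀ + σ²I)⁻¹ = σ⁻²(I − B(σ²Q + n_o AᵀA)⁻¹Bᵀ)`. -/
theorem gp_repeated_readings_woodbury
    (nu ny no : ℕ) (hno : 0 < no)
    (Q : Matrix (Fin nu) (Fin nu) ℝ) (hQ : IsUnit Q.det)
    (A : Matrix (Fin ny) (Fin nu) ℝ) (σ : ℝ) (hσ : σ ≠ 0)
    (hS : IsUnit (σ ^ 2 • Q + (no : ℝ) • (Aᵀ * A)).det)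
    (B : Matrix (Fin no × Fin ny) (Fin nu) ℝ)
    (hB : ∀ (i : Fin no) (j : Fin ny) (k : Fin nu), B (i, j) k = A j k) :
    Bᵀ * B = (no : ℝ) • (Aᵀ * A) ∧
    IsUnit (B * Q⁻¹ * Bᵀ
      + σ ^ 2 • (1 : Matrix (Fin no × Fin ny) (Fin no × Fin ny) ℝ)).det ∧
    (B * Q⁻¹ * Bᵀ
      + σ ^ 2 • (1 : Matrix (Fin no × Fin ny) (Fin no × Fin ny) ℝ))⁻¹ =
      (σ ^ 2)⁻¹ • ((1 : Matrix (Fin no × Fin ny) (Fin no × Fin ny) ℝ)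
        - B * (σ ^ 2 • Q + (no : ℝ) • (Aᵀ * A))⁻¹ * Bᵀ) := by
  have hBB : Bᵀ * B = (no : ℝ) • (Aᵀ * A) := by
    simpa using transpose_mul_self_of_stacked A B hB
  have hinv : (B * Q⁻¹ * Bᵀ + σ ^ 2 • (1 : Matrix (Fin no × Fin ny) (Fin no × Fin ny) ℝ)) *
      ((σ ^ 2)⁻¹ • (1 - B * (σ ^ 2 • Q + (no : ℝ) • (Aᵀ * A))⁻¹ * Bᵀ)) = 1 := by
    rw [← hBB] at hS ⊢
    rw [Matrix.mul_smul, mul_inv_mul_add_smul_one_mul Q B Bᵀ (σ ^ 2) hQ hS,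
      inv_smul_smul₀ (pow_ne_zero 2 hσ)]
  exact ⟨hBB, isUnit_det_of_right_inverse hinv, inv_eq_right_inv hinv⟩
end

section
/- Let Q be an invertible n_u×n_u real matrix, B an n_y×n_u real matrix, and σ a nonzero real number such that σ²Q + 2BᵀB is invertible. Set X = BQ⁻¹Bᵀ and W = σ⁻² B (σ²Q + 2BᵀB)⁻¹ Bᵀ. Then the 2×2 block matrix with blocks [X + σ²I, X; X, X + σ²I] is invertible, and its inverse equals the block matrix with blocks [σ⁻²I − W, −W; −W, σ⁻²I − W]. -/
open Matrix

/-- The resolvent-type identity `2XV = X - sV` for `X = BQ⁻¹Bᵀ` and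
`V = B(sQ + 2BᵀB)⁻¹Bᵀ`. -/
theorem two_smul_mul_inv_mul_inv {m n R : Type*} [Fintype m] [Fintype n] [DecidableEq n]
    [CommRing R] (Q : Matrix n n R) (hQ : IsUnit Q.det) (B : Matrix m n R) (s : R)
    (hS : IsUnit (s • Q + (2 : R) • (Bᵀ * B)).det) :
    (2 : R) • ((B * Q⁻¹ * Bᵀ) * (B * (s • Q + (2 : R) • (Bᵀ * B))⁻¹ * Bᵀ)) =
      B * Q⁻¹ * Bᵀ - s • (B * (s • Q + (2 : R) • (Bᵀ * B))⁻¹ * Bᵀ) := by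
  set S := s • Q + (2 : R) • (Bᵀ * B) with hSdef
  have hB : (2 : R) • (Bᵀ * B) = S - s • Q := by rw [hSdef, add_sub_cancel_left]
  calc (2 : R) • ((B * Q⁻¹ * Bᵀ) * (B * S⁻¹ * Bᵀ))
      = B * (Q⁻¹ * ((2 : R) • (Bᵀ * B)) * S⁻¹) * Bᵀ := by
        simp only [Matrix.mul_smul, Matrix.smul_mul, Matrix.mul_assoc]
    _ = B * (Q⁻¹ * (S * S⁻¹) - s • ((Q⁻¹ * Q) * S⁻¹)) * Bᵀ := by
        rw [hB]
        simp only [Matrix.mul_sub, Matrix.sub_mul, Matrix.mul_smul, Matrix.smul_mul,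
          Matrix.mul_assoc]
    _ = B * Q⁻¹ * Bᵀ - s • (B * S⁻¹ * Bᵀ) := by
        rw [Matrix.mul_nonsing_inv S hS, Matrix.nonsing_inv_mul Q hQ]
        simp only [Matrix.mul_sub, Matrix.sub_mul, Matrix.mul_smul, Matrix.smul_mul,
          Matrix.mul_one, Matrix.one_mul]

/-- Inverse of the joint marginal covariance for two repeated GP readings:
with `X = BQ⁻¹Bᵀ` and `W = σ⁻² B (σ²Q + 2BᵀB)⁻¹ Bᵀ`, the block matrix
`[X + σ²I, X; X, X + σ²I]` is invertible with inverse
`[σ⁻²I − W, −W; −W, σ⁻²I − W]`. -/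
theorem gp_two_readings_joint_inverse
    (nu ny : ℕ) (Q : Matrix (Fin nu) (Fin nu) ℝ) (hQ : IsUnit Q.det)
    (B : Matrix (Fin ny) (Fin nu) ℝ) (σ : ℝ) (hσ : σ ≠ 0)
    (hS : IsUnit (σ ^ 2 • Q + (2 : ℝ) • (Bᵀ * B)).det)
    (X W : Matrix (Fin ny) (Fin ny) ℝ)
    (hX : X = B * Q⁻¹ * Bᵀ)
    (hW : W = (σ ^ 2)⁻¹ • (B * (σ ^ 2 • Q + (2 : ℝ) • (Bᵀ * B))⁻¹ * Bᵀ)) :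
    IsUnit (Matrix.fromBlocks
      (X + σ ^ 2 • (1 : Matrix (Fin ny) (Fin ny) ℝ)) X X
      (X + σ ^ 2 • (1 : Matrix (Fin ny) (Fin ny) ℝ))).det ∧
    (Matrix.fromBlocks
      (X + σ ^ 2 • (1 : Matrix (Fin ny) (Fin ny) ℝ)) X X
      (X + σ ^ 2 • (1 : Matrix (Fin ny) (Fin ny) ℝ)))⁻¹ =
      Matrix.fromBlocks
        ((σ ^ 2)⁻¹ • (1 : Matrix (Fin ny) (Fin ny) ℝ) - W) (-W) (-W)
        ((σ ^ 2)⁻¹ • (1 : Matrix (Fin ny) (Fin ny) ℝ) - W) := by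
  have hs : σ ^ 2 ≠ 0 := pow_ne_zero 2 hσ
  have hXW : X * W + X * W = (σ ^ 2)⁻¹ • X - σ ^ 2 • W := by
    have h := two_smul_mul_inv_mul_inv Q hQ B (σ ^ 2) hS
    rw [← hX] at h
    rw [← two_smul ℝ, hW, Matrix.mul_smul, smul_comm, h, smul_sub, smul_comm (σ ^ 2)]
  have hdiag : (X + σ ^ 2 • (1 : Matrix (Fin ny) (Fin ny) ℝ)) * ((σ ^ 2)⁻¹ • 1 - W) +
      X * -W = 1 := by
    simp only [Matrix.add_mul, Matrix.mul_sub, Matrix.mul_smul, Matrix.smul_mul, Matrix.mul_one,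
      Matrix.one_mul, Matrix.mul_neg, smul_add, smul_smul, inv_mul_cancel₀ hs, one_smul]
    linear_combination (norm := abel) -hXW
  have hoff : (X + σ ^ 2 • (1 : Matrix (Fin ny) (Fin ny) ℝ)) * -W +
      X * ((σ ^ 2)⁻¹ • 1 - W) = 0 := by
    simp only [Matrix.add_mul, Matrix.mul_sub, Matrix.mul_smul, Matrix.smul_mul, Matrix.mul_one,
      Matrix.one_mul, Matrix.mul_neg]
    linear_combination (norm := abel) -hXW
  have hmul : Matrix.fromBlocks
      (X + σ ^ 2 • (1 : Matrix (Fin ny) (Fin ny) ℝ)) X X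
      (X + σ ^ 2 • (1 : Matrix (Fin ny) (Fin ny) ℝ)) *
      Matrix.fromBlocks
        ((σ ^ 2)⁻¹ • (1 : Matrix (Fin ny) (Fin ny) ℝ) - W) (-W) (-W)
        ((σ ^ 2)⁻¹ • (1 : Matrix (Fin ny) (Fin ny) ℝ) - W) = 1 := by
    rw [Matrix.fromBlocks_multiply, hdiag, hoff, add_comm (X * _), hoff, add_comm (X * _), hdiag,
      Matrix.fromBlocks_one]
  exact ⟨Matrix.isUnit_det_of_right_inverse hmul, Matrix.inv_eq_right_inv hmul⟩
end

section
/- Let Q_u be an invertible n_u×n_u real matrix, P an n_y×n_u real matrix, and D an invertible n_y×n_y real matrix such that Q_u + 2PᵀDP is invertible. Set X = PQ_u⁻¹Pᵀ and S = P (Q_u + 2PᵀDP)⁻¹ Pᵀ. Then the 2×2 block matrix with blocks [X + D⁻¹, X; X, X + D⁻¹] is invertible, and its inverse equals the block matrix with blocks [D − DSD, −DSD; −DSD, D − DSD]. -/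
open Matrix

/-- The resolvent identity behind the Woodbury formula, sandwiched between `P` and `R`. -/
lemma sandwich_sub_sandwich_eq {m n : Type*} [Fintype m] [Fintype n] [DecidableEq n]
    {K : Type*} [CommRing K] {A : Matrix n n K} (hA : IsUnit A.det) (P : Matrix m n K)
    (R : Matrix n m K) (D : Matrix m m K) (c : K)
    (hM : IsUnit (A + c • (R * D * P)).det) :
    P * A⁻¹ * R - P * (A + c • (R * D * P))⁻¹ * R =
      c • (P * A⁻¹ * R * D * (P * (A + c • (R * D * P))⁻¹ * R)) := by
  set M := A + c • (R * D * P) with hMdef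
  have key : A⁻¹ - M⁻¹ = c • (A⁻¹ * (R * D * P) * M⁻¹) := by
    calc A⁻¹ - M⁻¹ = A⁻¹ * (M - A) * M⁻¹ := by
          rw [Matrix.mul_sub, Matrix.sub_mul, nonsing_inv_mul A hA, Matrix.one_mul,
            mul_nonsing_inv_cancel_right M A⁻¹ hM]
      _ = c • (A⁻¹ * (R * D * P) * M⁻¹) := by
          rw [hMdef, add_sub_cancel_left, Matrix.mul_smul, Matrix.smul_mul]
  rw [← Matrix.sub_mul, ← Matrix.mul_sub, key]
  simp only [Matrix.mul_smul, Matrix.smul_mul, Matrix.mul_assoc]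

/-- Inverse of the joint marginal covariance for two repeated statFEM readings:
with `X = PQ_u⁻¹Pᵀ` and `S = P(Q_u + 2PᵀDP)⁻¹Pᵀ`, the block matrix
`[X + D⁻¹, X; X, X + D⁻¹]` is invertible with inverse
`[D − DSD, −DSD; −DSD, D − DSD]`. -/
theorem statfem_two_readings_joint_inverse
    (nu ny : ℕ) (Qu : Matrix (Fin nu) (Fin nu) ℝ) (hQu : IsUnit Qu.det)
    (P : Matrix (Fin ny) (Fin nu) ℝ)
    (D : Matrix (Fin ny) (Fin ny) ℝ) (hD : IsUnit D.det)
    (hpost : IsUnit (Qu + (2 : ℝ) • (Pᵀ * D * P)).det)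
    (X S : Matrix (Fin ny) (Fin ny) ℝ)
    (hX : X = P * Qu⁻¹ * Pᵀ)
    (hS : S = P * (Qu + (2 : ℝ) • (Pᵀ * D * P))⁻¹ * Pᵀ) :
    IsUnit (Matrix.fromBlocks (X + D⁻¹) X X (X + D⁻¹)).det ∧
    (Matrix.fromBlocks (X + D⁻¹) X X (X + D⁻¹))⁻¹ =
      Matrix.fromBlocks (D - D * S * D) (-(D * S * D)) (-(D * S * D))
        (D - D * S * D) := by
  have hXS : X - S = (2 : ℝ) • (X * D * S) := by
    subst hX hS
    exact sandwich_sub_sandwich_eq hQu P Pᵀ D 2 hpost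
  have hXD : X * D = X * (D * S * D) + X * (D * S * D) + S * D := by
    rw [← sub_eq_iff_eq_add, ← Matrix.sub_mul, hXS, two_smul, Matrix.add_mul]
    simp only [Matrix.mul_assoc]
  have hDD : D⁻¹ * D = 1 := nonsing_inv_mul D hD
  have hDSD : D⁻¹ * (D * S * D) = S * D := by
    rw [Matrix.mul_assoc D S D, nonsing_inv_mul_cancel_left D (S * D) hD]
  have hdiag : (X + D⁻¹) * (D - D * S * D) + X * -(D * S * D) = 1 := by
    rw [Matrix.add_mul, Matrix.mul_sub, Matrix.mul_sub, Matrix.mul_neg, hDD, hDSD, hXD]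
    abel
  have hoff : (X + D⁻¹) * -(D * S * D) + X * (D - D * S * D) = 0 := by
    rw [Matrix.mul_neg, Matrix.add_mul, Matrix.mul_sub, hDSD, hXD]
    abel
  have hmul : fromBlocks (X + D⁻¹) X X (X + D⁻¹) *
      fromBlocks (D - D * S * D) (-(D * S * D)) (-(D * S * D)) (D - D * S * D) = 1 := by
    rw [fromBlocks_multiply, hdiag, hoff, add_comm (X * (D - D * S * D)), hoff,
      add_comm (X * -(D * S * D)), hdiag, fromBlocks_one]
  exact ⟨isUnit_det_of_right_inverse hmul, inv_eq_right_inv hmul⟩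
end

section
/- Let Q_u be an invertible n_u×n_u real matrix, P an n_y×n_u real matrix, and D an invertible n_y×n_y real matrix. Set X = PQ_u⁻¹Pᵀ. Then det of the 2×2 block matrix with blocks [X + D⁻¹, X; X, X + D⁻¹], multiplied by det(Q_u) and by (det D)², equals det(Q_u + 2PᵀDP), i.e. det([X + D⁻¹, X; X, X + D⁻¹]) = det(Q_u + 2PᵀDP) · (det(D⁻¹))² / det(Q_u). -/
open Matrix

theorem Matrix.det_fromBlocks_add_self {n R : Type*} [Fintype n] [DecidableEq n] [CommRing R]
    (X A : Matrix n n R) :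
    (Matrix.fromBlocks (X + A) X X (X + A)).det = (A + (2 : R) • X).det * A.det := by
  have h : Matrix.fromBlocks 1 1 0 1 * Matrix.fromBlocks (X + A) X X (X + A) *
      Matrix.fromBlocks 1 (-1) 0 1 = Matrix.fromBlocks (A + (2 : R) • X) 0 X A := by
    rw [Matrix.fromBlocks_multiply, Matrix.fromBlocks_multiply]
    congr 1 <;> simp [two_smul] <;> abel
  simpa using congrArg Matrix.det h

theorem Matrix.det_add_smul_mul_mul {m n R : Type*} [Fintype m] [DecidableEq m] [Fintype n]
    [DecidableEq n] [CommRing R] {Q : Matrix n n R} (hQ : IsUnit Q.det) (U : Matrix n m R)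
    {D : Matrix m m R} (hD : IsUnit D.det) (V : Matrix m n R) (c : R) :
    (Q + c • (U * D * V)).det = Q.det * D.det * (D⁻¹ + c • (V * Q⁻¹ * U)).det := by
  have h₁ : Q + c • (U * D * V) = Q * (1 + Q⁻¹ * U * (c • (D * V))) := by
    simp only [Matrix.mul_add, Matrix.mul_one, Matrix.mul_smul, ← Matrix.mul_assoc,
      Matrix.mul_nonsing_inv Q hQ, Matrix.one_mul]
  have h₂ : 1 + c • (D * V) * (Q⁻¹ * U) = D * (D⁻¹ + c • (V * Q⁻¹ * U)) := by
    simp only [Matrix.mul_add, Matrix.mul_smul, Matrix.smul_mul, Matrix.mul_assoc,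
      Matrix.mul_nonsing_inv D hD]
  rw [h₁, Matrix.det_mul, Matrix.det_one_add_mul_comm, h₂, Matrix.det_mul, mul_assoc]

/-- Determinant identity for two repeated statFEM readings: with
`X = PQ_u⁻¹Pᵀ`,
`det([X + D⁻¹, X; X, X + D⁻¹]) · det(Q_u) · (det D)² = det(Q_u + 2PᵀDP)`, i.e.
`det([X + D⁻¹, X; X, X + D⁻¹]) = det(Q_u + 2PᵀDP) · (det(D⁻¹))² / det(Q_u)`. -/
theorem statfem_two_readings_det
    (nu ny : ℕ) (Qu : Matrix (Fin nu) (Fin nu) ℝ) (hQu : IsUnit Qu.det)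
    (P : Matrix (Fin ny) (Fin nu) ℝ)
    (D : Matrix (Fin ny) (Fin ny) ℝ) (hD : IsUnit D.det)
    (X : Matrix (Fin ny) (Fin ny) ℝ) (hX : X = P * Qu⁻¹ * Pᵀ) :
    (Matrix.fromBlocks (X + D⁻¹) X X (X + D⁻¹)).det * Qu.det * D.det ^ 2 =
      (Qu + (2 : ℝ) • (Pᵀ * D * P)).det ∧
    (Matrix.fromBlocks (X + D⁻¹) X X (X + D⁻¹)).det =
      (Qu + (2 : ℝ) • (Pᵀ * D * P)).det * (D⁻¹).det ^ 2 / Qu.det := by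
  have hQ : Qu.det ≠ 0 := hQu.ne_zero
  have hD' : D.det ≠ 0 := hD.ne_zero
  have hinv : (D⁻¹).det = (D.det)⁻¹ := by
    rw [Matrix.det_nonsing_inv, Ring.inverse_eq_inv']
  rw [Matrix.det_fromBlocks_add_self, Matrix.det_add_smul_mul_mul hQu Pᵀ hD P, ← hX, hinv]
  constructor <;> field_simp
end
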